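/- Let Z₁, …, Z_s be 2-squares with ideals (L_{i,1}², L_{i,2}²) ⊆ ℂ[x,y,z] and pairwise distinct supports P₁, …, P_s ∈ ℙ², and let I = ⋂_{i=1}^s (L_{i,1}², L_{i,2}²). Fix d ≥ 1 and suppose that dim_ℂ I_d ≥ 1 and that for every i, ( I ∩ I(P_i)³ )_d is a proper subspace of I_d, where I(P_i) is the ideal of the point P_i. Then there exists a nonzero F ∈ I_d such that for every i: F ∈ I(P_i)² but F ∉ I(P_i)³ (i.e. F defines a curve with a point of multiplicity exactly 2 at each P_i), and moreover for each i there exist a_i, b_i ∈ ℂ, not both zero, and a linear form N_i with N_i(P_i) ≠ 0, such that F − a_i L_{i,1}² N_i^{d−2} − b_i L_{i,2}² N_i^{d−2} ∈ I(P_i)³; so the degree-2 tangent cone of F at P_i is a_i L_{i,1}² + b_i L_{i,2}², a pair of lines symmetric with respect to the frame {L_{i,1}, L_{i,2}} when a_i b_i ≠ 0, or a double frame line otherwise. -/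

import Mathlib

open MvPolynomial

/-- The homogeneous ideal of the point of `ℙ²` with coordinates `P`: the ideal
generated by all linear forms vanishing at `P`. -/
noncomputable def pointIdeal (P : Fin 3 → ℂ) : Ideal (MvPolynomial (Fin 3) ℂ) :=
  Ideal.span {f : MvPolynomial (Fin 3) ℂ | f.IsHomogeneous 1 ∧ eval P f = 0}

/-- A homogeneous element of an ideal generated by two forms of the same degree is a combination
of these forms with homogeneous coefficients. -/
theorem MvPolynomial.IsHomogeneous.exists_eq_of_mem_span_pair {σ R : Type*} [CommRing R]
    {F u v : MvPolynomial σ R} {d n : ℕ} (hF : F.IsHomogeneous d)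
    (hu : u.IsHomogeneous n) (hv : v.IsHomogeneous n) (h : F ∈ Ideal.span {u, v}) :
    ∃ A B : MvPolynomial σ R, A.IsHomogeneous (d - n) ∧ B.IsHomogeneous (d - n) ∧
      F = A * u + B * v := by
  let := MvPolynomial.gradedAlgebra (σ := σ) (R := R)
  obtain ⟨A, B, rfl⟩ := Ideal.mem_span_pair.mp h
  have key := DirectSum.decompose_of_mem_same (homogeneousSubmodule σ R) hF
  rw [DirectSum.decompose_add, DirectSum.add_apply, Submodule.coe_add] at key
  by_cases hnd : n ≤ d
  · rw [DirectSum.coe_decompose_mul_of_right_mem_of_le _ hu hnd,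
      DirectSum.coe_decompose_mul_of_right_mem_of_le _ hv hnd] at key
    exact ⟨_, _, SetLike.coe_mem (DirectSum.decompose (homogeneousSubmodule σ R) A (d - n)),
      SetLike.coe_mem (DirectSum.decompose (homogeneousSubmodule σ R) B (d - n)), key.symm⟩
  · rw [DirectSum.coe_decompose_mul_of_right_mem_of_not_le _ hu hnd,
      DirectSum.coe_decompose_mul_of_right_mem_of_not_le _ hv hnd] at key
    exact ⟨0, 0, isHomogeneous_zero _ _ _, isHomogeneous_zero _ _ _, by simpa using key.symm⟩

theorem mem_pointIdeal {P : Fin 3 → ℂ} {f : MvPolynomial (Fin 3) ℂ} (hf : f.IsHomogeneous 1)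
    (h : eval P f = 0) : f ∈ pointIdeal P :=
  Ideal.subset_span ⟨hf, h⟩

/-- Modulo the ideal of `P`, a form is its value at `P` times a power of a linear form taking the
value `1` at `P`. -/
theorem sub_C_mul_pow_mem_pointIdeal {P : Fin 3 → ℂ} {N G : MvPolynomial (Fin 3) ℂ} {n : ℕ}
    (hN : N.IsHomogeneous 1) (hNP : eval P N = 1) (hG : G.IsHomogeneous n) :
    G - C (eval P G) * N ^ n ∈ pointIdeal P := by
  set q := Ideal.Quotient.mk (pointIdeal P)
  have hX (j : Fin 3) : q (X j) = q (C (P j) * N) := by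
    refine Ideal.Quotient.eq.mpr (mem_pointIdeal ?_ (by simp [hNP]))
    exact (isHomogeneous_X ℂ j).sub (hN.C_mul (P j))
  rw [← Ideal.Quotient.eq]
  change q G = q _
  conv_lhs => rw [G.as_sum]
  conv_rhs => rw [eval_eq, map_sum, Finset.sum_mul]
  rw [map_sum, map_sum]
  refine Finset.sum_congr rfl fun m hm => ?_
  have hdeg : ∑ j ∈ m.support, m j = n :=
    (hG.degree_eq_sum_deg_support hm).symm
  rw [monomial_eq, Finsupp.prod]
  simp only [map_mul, map_prod, map_pow, hX, mul_pow, Finset.prod_mul_distrib]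
  rw [Finset.prod_pow_eq_pow_sum, hdeg, mul_assoc]

/-- A point of `ℙ²` admits a linear form taking the value `1` at it. -/
theorem exists_isHomogeneous_one_eval_eq_one {P : Fin 3 → ℂ} (hP : P ≠ 0) :
    ∃ N : MvPolynomial (Fin 3) ℂ, N.IsHomogeneous 1 ∧ eval P N = 1 := by
  obtain ⟨k, hk⟩ := Function.ne_iff.mp hP
  exact ⟨C (P k)⁻¹ * X k, (isHomogeneous_X ℂ k).C_mul _, by simpa using inv_mul_cancel₀ hk⟩

/-- A finite family of subspaces strictly contained in a subspace `V` over an infinite field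
does not cover `V`. -/
theorem Submodule.exists_mem_forall_notMem_of_lt {ι K E : Type*} [Finite ι] [Field K] [Infinite K]
    [AddCommGroup E] [Module K E] {V : Submodule K E} {W : ι → Submodule K E}
    (h : ∀ i, W i < V) : ∃ x ∈ V, ∀ i, x ∉ W i := by
  by_contra! hcon
  obtain ⟨i, hi⟩ := Subspace.exists_eq_top_of_iUnion_eq_univ
    (p := fun i => (W i).comap V.subtype) <| Set.eq_univ_of_forall fun x => by
      simpa using hcon x x.2
  exact (h i).not_ge (Submodule.comap_subtype_eq_top.mp hi)

/-- The interpolation statement: if the degree-`d` part of the ideal of a union of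
2-squares with distinct supports is nonzero, and for each support point the forms
that are moreover triple at that point form a proper subspace, then there is a
nonzero degree-`d` form in the ideal with a point of multiplicity exactly 2 at
each support, whose tangent cone there is `aᵢLᵢ₁² + bᵢLᵢ₂²`. -/
theorem stmt_15 (s : ℕ) (hs : 1 ≤ s)
    (L : Fin s → Fin 2 → MvPolynomial (Fin 3) ℂ)
    (hhom : ∀ i j, (L i j).IsHomogeneous 1)
    (hind : ∀ i, LinearIndependent ℂ (L i))
    (P : Fin s → Fin 3 → ℂ) (hP0 : ∀ i, P i ≠ 0)
    (hsupp : ∀ i j, eval (P i) (L i j) = 0)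
    (hdist : ∀ i j, i ≠ j → ∀ c : ℂ, P j ≠ c • P i)
    (d : ℕ) (hd : 1 ≤ d)
    (hpos : 1 ≤ Module.finrank ℂ
      ((Submodule.restrictScalars ℂ (⨅ i, Ideal.span {(L i 0) ^ 2, (L i 1) ^ 2}) ⊓
          homogeneousSubmodule (Fin 3) ℂ d : Submodule ℂ (MvPolynomial (Fin 3) ℂ))))
    (hproper : ∀ i,
      (Submodule.restrictScalars ℂ
          ((⨅ i, Ideal.span {(L i 0) ^ 2, (L i 1) ^ 2}) ⊓ (pointIdeal (P i)) ^ 3) ⊓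
        homogeneousSubmodule (Fin 3) ℂ d : Submodule ℂ (MvPolynomial (Fin 3) ℂ)) <
      (Submodule.restrictScalars ℂ (⨅ i, Ideal.span {(L i 0) ^ 2, (L i 1) ^ 2}) ⊓
        homogeneousSubmodule (Fin 3) ℂ d : Submodule ℂ (MvPolynomial (Fin 3) ℂ))) :
    ∃ F : MvPolynomial (Fin 3) ℂ, F ≠ 0 ∧
      F ∈ (⨅ i, Ideal.span {(L i 0) ^ 2, (L i 1) ^ 2}) ∧
      F.IsHomogeneous d ∧
      ∀ i, F ∈ (pointIdeal (P i)) ^ 2 ∧ F ∉ (pointIdeal (P i)) ^ 3 ∧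
        ∃ (a b : ℂ) (N : MvPolynomial (Fin 3) ℂ),
          (a ≠ 0 ∨ b ≠ 0) ∧ N.IsHomogeneous 1 ∧ eval (P i) N ≠ 0 ∧
          F - C a * (L i 0) ^ 2 * N ^ (d - 2) - C b * (L i 1) ^ 2 * N ^ (d - 2) ∈
            (pointIdeal (P i)) ^ 3 := by
  obtain ⟨F, ⟨hFI, hFd⟩, hF⟩ := Submodule.exists_mem_forall_notMem_of_lt hproper
  have hF3 (i : Fin s) : F ∉ pointIdeal (P i) ^ 3 := fun h => hF i ⟨⟨hFI, h⟩, hFd⟩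
  refine ⟨F, ?_, hFI, hFd, fun i => ?_⟩
  · rintro rfl
    exact hF3 ⟨0, hs⟩ (zero_mem _)
  have hL (j : Fin 2) : L i j ^ 2 ∈ pointIdeal (P i) ^ 2 :=
    Ideal.pow_mem_pow (mem_pointIdeal (hhom i j) (hsupp i j)) 2
  obtain ⟨A, B, hA, hB, rfl⟩ := IsHomogeneous.exists_eq_of_mem_span_pair hFd
    ((hhom i 0).pow 2) ((hhom i 1).pow 2) ((Submodule.mem_iInf _).mp hFI i)
  obtain ⟨N, hN, hNP⟩ := exists_isHomogeneous_one_eval_eq_one (hP0 i)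
  have hcone : A * L i 0 ^ 2 + B * L i 1 ^ 2 - C (eval (P i) A) * L i 0 ^ 2 * N ^ (d - 2) -
      C (eval (P i) B) * L i 1 ^ 2 * N ^ (d - 2) ∈ pointIdeal (P i) ^ 3 := by
    have hA' := Ideal.mul_mem_mul (sub_C_mul_pow_mem_pointIdeal hN hNP hA) (hL 0)
    have hB' := Ideal.mul_mem_mul (sub_C_mul_pow_mem_pointIdeal hN hNP hB) (hL 1)
    rw [← pow_succ'] at hA' hB'
    convert add_mem hA' hB' using 1
    ring
  refine ⟨add_mem (Ideal.mul_mem_left _ _ (hL 0)) (Ideal.mul_mem_left _ _ (hL 1)), hF3 i,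
    eval (P i) A, eval (P i) B, N, ?_, hN, by simp [hNP], hcone⟩
  by_contra! hab
  refine hF3 i ?_
  simpa [hab.1, hab.2] using hcone
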